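/- The type-III Lawson–Osserman map F'' : ℂ⁸ → ℝ^{25} defined by F''(z) = ( sqrt(28/45)·(Re(z), Im(z)), sqrt(17/45)·(f_1, f_2, …, f_9) ) sends the unit sphere S^{15} ⊂ ℂ⁸ into the unit sphere S^{24} ⊂ ℝ^{25}: if Σ_{k=1}^{8} |z_k|² = 1 then the Euclidean norm of F''(z) equals 1. -/

import Mathlib

open scoped BigOperators

open Complex in
/-- The four complex quadratic polynomials `a₁, a₂, a₃, a₄` (components of
`2·conj(p₁)p₂` for octonions), as a function `Fin 4 → ℂ`; the eight complex
variables `z_1, …, z_8` are indexed by `Fin 8` (0-based). -/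
noncomputable def octA (z : Fin 8 → ℂ) : Fin 4 → ℂ :=
  ![(starRingEnd ℂ) (z 0) * z 4 + z 1 * (starRingEnd ℂ) (z 5) +
      z 2 * (starRingEnd ℂ) (z 6) + (starRingEnd ℂ) (z 3) * z 7,
    (starRingEnd ℂ) (z 0) * z 5 - z 1 * (starRingEnd ℂ) (z 4) -
      (starRingEnd ℂ) (z 2) * z 7 + z 3 * (starRingEnd ℂ) (z 6),
    (starRingEnd ℂ) (z 0) * z 6 + (starRingEnd ℂ) (z 1) * z 7 -
      z 2 * (starRingEnd ℂ) (z 4) - z 3 * (starRingEnd ℂ) (z 5),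
    z 0 * z 7 - z 1 * z 6 + z 2 * z 5 - z 3 * z 4]

/-- `f₁ = Σ_{k=1}^4 |z_k|² − Σ_{k=5}^8 |z_k|²`. -/
noncomputable def octf1 (z : Fin 8 → ℂ) : ℝ :=
  (Complex.normSq (z 0) + Complex.normSq (z 1) + Complex.normSq (z 2) +
      Complex.normSq (z 3)) -
    (Complex.normSq (z 4) + Complex.normSq (z 5) + Complex.normSq (z 6) +
      Complex.normSq (z 7))

/-- The nine real functions `(f₁, …, f₉)`, i.e. the (normalized) octonionic
Hopf map, as a point of `ℝ⁹`. -/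
noncomputable def octHopf (z : Fin 8 → ℂ) : EuclideanSpace ℝ (Fin 9) :=
  (WithLp.equiv 2 (Fin 9 → ℝ)).symm
    ![octf1 z,
      2 * (octA z 0).re, 2 * (octA z 1).re, 2 * (octA z 2).re, 2 * (octA z 3).re,
      2 * (octA z 0).im, 2 * (octA z 1).im, 2 * (octA z 2).im, 2 * (octA z 3).im]

/-- The type-III Lawson–Osserman map
`F''(z) = (√(28/45)(Re z, Im z), √(17/45)(f₁, …, f₉)) ∈ ℝ⁸ × ℝ⁸ × ℝ⁹ = ℝ²⁵`. -/
noncomputable def LOFIII (z : Fin 8 → ℂ) : EuclideanSpace ℝ (Fin 8 ⊕ Fin 8 ⊕ Fin 9) :=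
  (WithLp.equiv 2 (Fin 8 ⊕ Fin 8 ⊕ Fin 9 → ℝ)).symm fun i =>
    match i with
    | Sum.inl k => Real.sqrt (28 / 45) * (z k).re
    | Sum.inr (Sum.inl k) => Real.sqrt (28 / 45) * (z k).im
    | Sum.inr (Sum.inr j) => Real.sqrt (17 / 45) * (octHopf z) j

theorem sum_normSq_octA (z : Fin 8 → ℂ) :
    ∑ k : Fin 4, Complex.normSq (octA z k) =
      (Complex.normSq (z 0) + Complex.normSq (z 1) + Complex.normSq (z 2) +
        Complex.normSq (z 3)) *
      (Complex.normSq (z 4) + Complex.normSq (z 5) + Complex.normSq (z 6) +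
        Complex.normSq (z 7)) := by
  simp only [Fin.sum_univ_four, octA, Matrix.cons_val, Complex.normSq_apply, Complex.add_re,
    Complex.add_im, Complex.sub_re, Complex.sub_im, Complex.mul_re, Complex.mul_im,
    Complex.conj_re, Complex.conj_im]
  ring

theorem sum_sq_octHopf (z : Fin 8 → ℂ) :
    ∑ j : Fin 9, octHopf z j ^ 2 = (∑ k : Fin 8, Complex.normSq (z k)) ^ 2 := by
  have hA := sum_normSq_octA z
  have hsum : ∑ j : Fin 9, octHopf z j ^ 2 =
      octf1 z ^ 2 + 4 * ∑ k : Fin 4, Complex.normSq (octA z k) := by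
    simp only [Fin.sum_univ_succ, octHopf, Complex.normSq_apply]
    simp
    ring
  rw [hsum, hA, octf1, Fin.sum_univ_eight]
  ring

theorem norm_sq_LOFIII (z : Fin 8 → ℂ) :
    ‖LOFIII z‖ ^ 2 = 28 / 45 * (∑ k : Fin 8, Complex.normSq (z k)) +
      17 / 45 * (∑ k : Fin 8, Complex.normSq (z k)) ^ 2 := by
  rw [← sum_sq_octHopf, EuclideanSpace.real_norm_sq_eq]
  simp only [Fintype.sum_sum_type, LOFIII, WithLp.equiv_symm_apply, mul_pow,
    Real.sq_sqrt (show (0 : ℝ) ≤ 28 / 45 by norm_num),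
    Real.sq_sqrt (show (0 : ℝ) ≤ 17 / 45 by norm_num), ← Finset.mul_sum,
    Complex.normSq_apply, Finset.sum_add_distrib, ← sq]
  ring

/-- The type-III Lawson–Osserman map `F''` sends the unit
sphere `S^{15} ⊂ ℂ⁸` into the unit sphere `S^{24} ⊂ ℝ^{25}`. -/
theorem typeIII_LO_sphere_to_sphere (z : Fin 8 → ℂ)
    (hz : ∑ k : Fin 8, Complex.normSq (z k) = 1) :
    ‖LOFIII z‖ = 1 := by
  rw [← sq_eq_sq₀ (norm_nonneg _) zero_le_one, norm_sq_LOFIII, hz]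
  norm_num
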